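/- Let G be an abelian group, let A, B ⊆ G be finite nonempty subsets, let f : G → ℝ be nonnegative, and let k ≥ 2 be an integer. For x ∈ G set R(x) := #{(a, b) ∈ A × B : a − b = x}. Then there exist s₁, …, s_{k−1} ∈ G such that, setting A′ := A ∩ (A + s₁) ∩ ⋯ ∩ (A + s_{k−1}) and B′ := B ∩ (B + s₁) ∩ ⋯ ∩ (B + s_{k−1}), one has: (1) (Σ_{x} R(x)^k) · (Σ_{a∈A′} Σ_{b∈B′} f(a − b)) ≤ 2 · (Σ_{x} R(x)^k · f(x)) · |A′| · |B′|; (2) 4 · |A′| · |B|^k ≥ Σ_{x} R(x)^k; and (3) 4 · |B′| · |A|^k ≥ Σ_{x} R(x)^k. (All sums over x range over the finite set A − B, outside of which R vanishes.) -/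

import Mathlib

open Pointwise

/-- Averaging: if `∑ αβ ≥ N`, while `∑ φ ≤ F`, `∑ α ≤ P` and `∑ β ≤ Q`, then some index has both
`α` and `β` large and `φ` small compared with `αβ`. -/
theorem exists_sifted_index {ι : Type*} (S : Finset ι) (α β φ : ι → ℝ) {N F P Q : ℝ}
    (hα : ∀ s, 0 ≤ α s) (hβ : ∀ s, 0 ≤ β s) (hφ : ∀ s, 0 ≤ φ s)
    (hN : 0 < N) (hF : 0 ≤ F) (hP : 0 < P) (hQ : 0 < Q)
    (hαβ : N ≤ ∑ s ∈ S, α s * β s) (hφF : ∑ s ∈ S, φ s ≤ F)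
    (hαP : ∑ s ∈ S, α s ≤ P) (hβQ : ∑ s ∈ S, β s ≤ Q) :
    ∃ s ∈ S, N * φ s ≤ 2 * F * (α s * β s) ∧ N ≤ 4 * α s * Q ∧ N ≤ 4 * β s * P := by
  classical
  set T := S.filter fun s => N ≤ 4 * α s * Q ∧ N ≤ 4 * β s * P
  have hbad : ∑ s ∈ S.filter (fun s => ¬(N ≤ 4 * α s * Q ∧ N ≤ 4 * β s * P)), α s * β s ≤
      N / 2 := by
    calc ∑ s ∈ S.filter (fun s => ¬(N ≤ 4 * α s * Q ∧ N ≤ 4 * β s * P)), α s * β s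
        ≤ ∑ s ∈ S.filter (fun s => ¬(N ≤ 4 * α s * Q ∧ N ≤ 4 * β s * P)),
            (N / (4 * Q) * β s + N / (4 * P) * α s) := by
          refine Finset.sum_le_sum fun s hs => ?_
          have hs := (Finset.mem_filter.1 hs).2
          have h₁ : 0 ≤ N / (4 * Q) * β s := mul_nonneg (by positivity) (hβ s)
          have h₂ : 0 ≤ N / (4 * P) * α s := mul_nonneg (by positivity) (hα s)
          by_cases h : N ≤ 4 * α s * Q
          · have h' : 4 * β s * P < N := by
              by_contra! h'
              exact hs ⟨h, h'⟩
            have : β s ≤ N / (4 * P) := by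
              rw [le_div_iff₀ (by positivity)]
              linarith
            nlinarith [mul_le_mul_of_nonneg_right this (hα s)]
          · have : α s ≤ N / (4 * Q) := by
              rw [le_div_iff₀ (by positivity)]
              linarith
            nlinarith [mul_le_mul_of_nonneg_right this (hβ s)]
      _ ≤ ∑ s ∈ S, (N / (4 * Q) * β s + N / (4 * P) * α s) :=
          Finset.sum_le_sum_of_subset_of_nonneg (Finset.filter_subset _ _) fun s _ _ =>
            add_nonneg (mul_nonneg (by positivity) (hβ s)) (mul_nonneg (by positivity) (hα s))
      _ = N / (4 * Q) * ∑ s ∈ S, β s + N / (4 * P) * ∑ s ∈ S, α s := by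
          rw [Finset.sum_add_distrib, Finset.mul_sum, Finset.mul_sum]
      _ ≤ N / (4 * Q) * Q + N / (4 * P) * P := by gcongr
      _ = N / 2 := by
          field_simp
          ring
  have hgood : N / 2 ≤ ∑ s ∈ T, α s * β s := by
    have := Finset.sum_filter_add_sum_filter_not S
      (fun s => N ≤ 4 * α s * Q ∧ N ≤ 4 * β s * P) (fun s => α s * β s)
    linarith
  have hTne : T.Nonempty := by
    by_contra h
    rw [Finset.not_nonempty_iff_eq_empty] at h
    rw [h, Finset.sum_empty] at hgood
    linarith
  have hsum : ∑ s ∈ T, N * φ s ≤ ∑ s ∈ T, 2 * F * (α s * β s) := by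
    rw [← Finset.mul_sum, ← Finset.mul_sum]
    have : ∑ s ∈ T, φ s ≤ F :=
      (Finset.sum_le_sum_of_subset_of_nonneg (Finset.filter_subset _ _) fun s _ _ => hφ s).trans hφF
    calc N * ∑ s ∈ T, φ s ≤ N * F := by gcongr
      _ = 2 * F * (N / 2) := by ring
      _ ≤ _ := by gcongr
  obtain ⟨s, hs, h⟩ := Finset.exists_le_of_sum_le hTne hsum
  exact ⟨s, (Finset.mem_filter.1 hs).1, h, (Finset.mem_filter.1 hs).2⟩

/-- Double counting of tuples `s ∈ Dⁿ` all of whose entries are related to a point of `X`. -/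
theorem sum_piFinset_sum_filter_forall {X G : Type*} [DecidableEq G] (n : ℕ) (D : Finset G)
    (C : Finset X) (p : X → G → Prop) [∀ x, DecidablePred (p x)] (h : X → ℝ) :
    ∑ s ∈ Fintype.piFinset (fun _ : Fin n => D), ∑ x ∈ C.filter (fun x => ∀ i, p x (s i)), h x =
      ∑ x ∈ C, ((D.filter (p x)).card : ℝ) ^ n * h x := by
  simp_rw [Finset.sum_filter]
  rw [Finset.sum_comm]
  refine Finset.sum_congr rfl fun x _ => ?_
  rw [← Finset.sum_filter, Finset.sum_const, nsmul_eq_mul]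
  have : (Fintype.piFinset fun _ : Fin n => D).filter (fun s => ∀ i, p x (s i)) =
      Fintype.piFinset fun _ : Fin n => D.filter (p x) := by
    ext s
    simp [Fintype.mem_piFinset, forall_and]
  rw [this, Fintype.card_piFinset_const, Nat.cast_pow]

section Differences

variable {G : Type*} [AddCommGroup G] [DecidableEq G]

theorem card_filter_sub_mem_le (D B : Finset G) (b : G) :
    (D.filter fun s => b - s ∈ B).card ≤ B.card :=
  Finset.card_le_card_of_injOn (fun s => b - s) (fun _ hs => (Finset.mem_filter.1 hs).2)
    fun _ _ _ _ h => sub_right_injective h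

theorem card_filter_sub_mem_and_sub_mem (A B : Finset G) {a : G} (ha : a ∈ A) (b : G) :
    ((A - A).filter fun s => a - s ∈ A ∧ b - s ∈ B).card =
      ((A ×ˢ B).filter fun p => p.1 - p.2 = a - b).card := by
  refine Finset.card_bij (fun s _ => (a - s, b - s)) ?_ ?_ ?_
  · intro s hs
    simpa using (Finset.mem_filter.1 hs).2
  · intro s _ t _ h
    exact sub_right_injective (Prod.ext_iff.1 h).1
  · rintro ⟨x, y⟩ h
    simp only [Finset.mem_filter, Finset.mem_product] at h
    obtain ⟨⟨hx, hy⟩, hxy⟩ := h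
    have hb : b - (a - x) = y := by
      rw [← sub_sub_self x y, hxy]
      abel
    refine ⟨a - x, Finset.mem_filter.2 ⟨Finset.sub_mem_sub ha hx, ?_, ?_⟩, ?_⟩
    · simpa using hx
    · rwa [hb]
    · rw [hb, sub_sub_cancel]

/-- Summing `h (a - b)` over `A × B` weights each difference by its number of representations. -/
theorem sum_product_sub_eq (A B : Finset G) (h : G → ℝ) :
    ∑ p ∈ A ×ˢ B, h (p.1 - p.2) =
      ∑ x ∈ A - B, (((A ×ˢ B).filter fun p => p.1 - p.2 = x).card : ℝ) * h x := by
  rw [← Finset.sum_fiberwise_of_maps_to (t := A - B) (g := fun p : G × G => p.1 - p.2)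
    fun p hp => Finset.sub_mem_sub (Finset.mem_product.1 hp).1 (Finset.mem_product.1 hp).2]
  refine Finset.sum_congr rfl fun x _ => ?_
  rw [Finset.sum_congr rfl (g := fun _ => h x)
    (fun p hp => by rw [(Finset.mem_filter.1 hp).2]), Finset.sum_const, nsmul_eq_mul]

theorem sum_piFinset_sum_sifted_sub (A B : Finset G) (n : ℕ) (h : G → ℝ) :
    ∑ s ∈ Fintype.piFinset (fun _ : Fin n => A - A),
        ∑ a ∈ A.filter (fun a => ∀ i, a - s i ∈ A), ∑ b ∈ B.filter (fun b => ∀ i, b - s i ∈ B),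
          h (a - b) =
      ∑ x ∈ A - B, (((A ×ˢ B).filter fun p => p.1 - p.2 = x).card : ℝ) ^ (n + 1) * h x := by
  have hprod (s : Fin n → G) :
      ∑ a ∈ A.filter (fun a => ∀ i, a - s i ∈ A), ∑ b ∈ B.filter (fun b => ∀ i, b - s i ∈ B),
          h (a - b) =
        ∑ p ∈ (A ×ˢ B).filter (fun p => ∀ i, p.1 - s i ∈ A ∧ p.2 - s i ∈ B), h (p.1 - p.2) := by
    simp_rw [forall_and]
    rw [Finset.filter_product (s := A) (t := B) (fun a => ∀ i, a - s i ∈ A)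
      (fun b => ∀ i, b - s i ∈ B), Finset.sum_product]
  simp_rw [hprod]
  rw [sum_piFinset_sum_filter_forall n (A - A) (A ×ˢ B)
    (fun p t => p.1 - t ∈ A ∧ p.2 - t ∈ B) (fun p => h (p.1 - p.2))]
  rw [Finset.sum_congr rfl fun p hp => by
    rw [card_filter_sub_mem_and_sub_mem A B (Finset.mem_product.1 hp).1 p.2]]
  rw [sum_product_sub_eq A B
    (fun x => (((A ×ˢ B).filter fun p => p.1 - p.2 = x).card : ℝ) ^ n * h x)]
  exact Finset.sum_congr rfl fun x _ => by ring

theorem sum_piFinset_card_sifted_le (D B : Finset G) (n : ℕ) :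
    ∑ s ∈ Fintype.piFinset (fun _ : Fin n => D),
        ((B.filter fun b => ∀ i, b - s i ∈ B).card : ℝ) ≤ (B.card : ℝ) ^ (n + 1) := by
  have := sum_piFinset_sum_filter_forall n D B (fun b t => b - t ∈ B) (fun _ => 1)
  simp only [Finset.sum_const, nsmul_eq_mul, mul_one] at this
  rw [this]
  calc ∑ b ∈ B, ((D.filter fun t => b - t ∈ B).card : ℝ) ^ n ≤ ∑ _b ∈ B, (B.card : ℝ) ^ n := by
        refine Finset.sum_le_sum fun b _ => pow_le_pow_left₀ (Nat.cast_nonneg _) ?_ n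
        exact_mod_cast card_filter_sub_mem_le D B b
    _ = (B.card : ℝ) ^ (n + 1) := by
        rw [Finset.sum_const, nsmul_eq_mul]
        ring

end Differences

/-- Sifting general convolutions (counting formulation). -/
theorem sifting_general_convolutions {G : Type*} [AddCommGroup G] [DecidableEq G]
    (A B : Finset G) (hA : A.Nonempty) (hB : B.Nonempty)
    (f : G → ℝ) (hf : ∀ x, 0 ≤ f x) (k : ℕ) (hk : 2 ≤ k) :
    ∃ s : Fin (k-1) → G,
      ∃ A' B' : Finset G,
      A' = A.filter (fun a => ∀ i : Fin (k-1), a - s i ∈ A) ∧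
      B' = B.filter (fun b => ∀ i : Fin (k-1), b - s i ∈ B) ∧
      -- (1)
      (∑ x ∈ A - B, (((A ×ˢ B).filter fun p => p.1 - p.2 = x).card : ℝ) ^ k) *
          (∑ a ∈ A', ∑ b ∈ B', f (a - b)) ≤
        2 * (∑ x ∈ A - B, (((A ×ˢ B).filter fun p => p.1 - p.2 = x).card : ℝ) ^ k * f x) *
          ((A'.card : ℝ) * (B'.card : ℝ)) ∧
      -- (2)
      (∑ x ∈ A - B, (((A ×ˢ B).filter fun p => p.1 - p.2 = x).card : ℝ) ^ k) ≤
        4 * (A'.card : ℝ) * (B.card : ℝ) ^ k ∧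
      -- (3)
      (∑ x ∈ A - B, (((A ×ˢ B).filter fun p => p.1 - p.2 = x).card : ℝ) ^ k) ≤
        4 * (B'.card : ℝ) * (A.card : ℝ) ^ k := by
  obtain ⟨n, rfl⟩ : ∃ n, k = n + 1 := ⟨k - 1, by omega⟩
  have hcard := sum_piFinset_sum_sifted_sub A B n (fun _ => 1)
  simp only [Finset.sum_const, nsmul_eq_mul, mul_one] at hcard
  have hN : 0 < ∑ x ∈ A - B,
      (((A ×ˢ B).filter fun p => p.1 - p.2 = x).card : ℝ) ^ (n + 1) := by
    refine Finset.sum_pos (fun x hx => ?_) (hA.sub hB)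
    obtain ⟨a, ha, b, hb, rfl⟩ := Finset.mem_sub.1 hx
    have : 0 < ((A ×ˢ B).filter fun p => p.1 - p.2 = a - b).card :=
      Finset.card_pos.2 ⟨(a, b), by simp [ha, hb]⟩
    positivity
  have hA' : (0 : ℝ) < A.card := by exact_mod_cast hA.card_pos
  have hB' : (0 : ℝ) < B.card := by exact_mod_cast hB.card_pos
  obtain ⟨s, -, h⟩ := exists_sifted_index (Fintype.piFinset fun _ : Fin n => A - A)
    (fun s => ((A.filter fun a => ∀ i, a - s i ∈ A).card : ℝ))
    (fun s => ((B.filter fun b => ∀ i, b - s i ∈ B).card : ℝ))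
    (fun s => ∑ a ∈ A.filter (fun a => ∀ i, a - s i ∈ A),
      ∑ b ∈ B.filter (fun b => ∀ i, b - s i ∈ B), f (a - b))
    (fun _ => Nat.cast_nonneg _) (fun _ => Nat.cast_nonneg _)
    (fun _ => Finset.sum_nonneg fun _ _ => Finset.sum_nonneg fun _ _ => hf _)
    hN (Finset.sum_nonneg fun x _ => mul_nonneg (by positivity) (hf x))
    (pow_pos hA' (n + 1)) (pow_pos hB' (n + 1)) hcard.ge
    (sum_piFinset_sum_sifted_sub A B n f).le
    (sum_piFinset_card_sifted_le _ A n) (sum_piFinset_card_sifted_le _ B n)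
  exact ⟨s, _, _, rfl, rfl, h⟩
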